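/- Let a ≥ 0, b ≥ 0, C > 0, α ≥ 1 and δ > 0 be real numbers, and set β = (α + δ)/α. Suppose that for every λ > 0 one has a · λ^{α} ≤ C · ( b^{1/β²} · λ^{(α+δ)/β²} + b · λ^{α+δ} ). Then a ≤ (β^{1/(1+β)} + β^{−β/(1+β)}) · C · b^{α/(α+δ)}. -/

import Mathlib

open Real

/-- The scaling argument of Remark 2.11: if `a λ^α ≤ C (b^{1/β²} λ^{(α+δ)/β²} + b λ^{α+δ})`
for every `λ > 0`, where `β = (α+δ)/α`, then
`a ≤ (β^{1/(1+β)} + β^{−β/(1+β)}) C b^{α/(α+δ)}`. -/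
theorem scaling_optimization_bound
    (a b C α δ : ℝ) (ha : 0 ≤ a) (hb : 0 ≤ b) (hC : 0 < C)
    (hα : 1 ≤ α) (hδ : 0 < δ)
    (β : ℝ) (hβ : β = (α + δ) / α)
    (h : ∀ l : ℝ, 0 < l →
      a * l ^ α ≤ C * (b ^ (1 / β ^ 2) * l ^ ((α + δ) / β ^ 2) + b * l ^ (α + δ))) :
    a ≤ (β ^ (1 / (1 + β)) + β ^ (-(β / (1 + β)))) * C * b ^ (α / (α + δ)) := by
  have hα0 : 0 < α := by linarith
  have hβ1 : 1 < β := by rw [hβ, one_lt_div hα0]; linarith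
  have hβ0 : 0 < β := by linarith
  have hsum : α + δ = α * β := by rw [hβ]; field_simp
  have hquot : α / (α + δ) = 1 / β := by rw [hsum]; field_simp
  rw [hquot]
  rw [hsum] at h
  rcases hb.eq_or_lt with rfl | hb0
  · have h1 := h 1 one_pos
    rw [zero_rpow (by positivity)] at h1 ⊢
    simpa using h1
  · have hd : β - 1 ≠ 0 := by linarith
    have hd' : 1 + β ≠ 0 := by linarith
    set s : ℝ := (-(log b / β) - β * log β / ((β - 1) * (1 + β))) / α with hs
    have first : b ^ (1 / β ^ 2) * exp s ^ (α * β / β ^ 2)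
        = β ^ (1 / (1 + β)) * b ^ (1 / β) * exp s ^ α := by
      simp only [rpow_def_of_pos hb0, rpow_def_of_pos hβ0, rpow_def_of_pos (exp_pos s),
        log_exp, ← exp_add]
      congr 1
      rw [hs]
      field_simp
      ring
    have second : b * exp s ^ (α * β)
        = β ^ (-(β / (1 + β))) * b ^ (1 / β) * exp s ^ α := by
      nth_rewrite 1 [← exp_log hb0]
      simp only [rpow_def_of_pos hb0, rpow_def_of_pos hβ0, rpow_def_of_pos (exp_pos s),
        log_exp, ← exp_add]
      congr 1
      rw [hs]
      field_simp
      ring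
    have key := h (exp s) (exp_pos s)
    rw [first, second] at key
    refine le_of_mul_le_mul_right (key.trans_eq ?_) (rpow_pos_of_pos (exp_pos s) α)
    ring
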